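/- arXiv:2109.06423 — 4 statements merged into one kernel-verified Lean document; each statement's English description precedes it below -/
import Mathlib

section
/- Let N = (N00, N10, N20, N01, N02, N11, N21, N12, N22) be a family of 2D-PI kernels of size n×m with N00 = 0, N01 = 0 and N02 = 0, and suppose each of the kernels N10, N20, N11, N21, N12, N22 has a continuous partial derivative with respect to its first argument x on its whole domain. Define the family M of 2D-PI kernels of size n×m by M00(x,y) = N10(x,y,x) − N20(x,y,x); M01(x,y,ν) = N11(x,y,x,ν) − N21(x,y,x,ν); M02(x,y,ν) = N12(x,y,x,ν) − N22(x,y,x,ν); M10 = ∂ₓN10; M20 = ∂ₓN20; M11 = ∂ₓN11; M21 = ∂ₓN21; M12 = ∂ₓN12; M22 = ∂ₓN22. Then for every continuous u : [a,b]×[c,d] → ℝ^m and every y ∈ [c,d], the function x ↦ (P[N]u)(x,y) is differentiable on [a,b] and its derivative satisfies ∂ₓ(P[N]u)(x,y) = (P[M]u)(x,y) for all x ∈ [a,b]. -/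
open Matrix MeasureTheory Set

noncomputable section

/-- A family of 1D-PI kernels of size `p × r` (the parameters of a 1D-PI operator). -/
structure PI1DK (p r : ℕ) where
  k0 : ℝ → Matrix (Fin p) (Fin r) ℝ
  k1 : ℝ → ℝ → Matrix (Fin p) (Fin r) ℝ
  k2 : ℝ → ℝ → Matrix (Fin p) (Fin r) ℝ

/-- Continuity of a family of 1D-PI kernels on the interval `[s,t]`. -/
def PI1DK.IsCont {p r : ℕ} (s t : ℝ) (N : PI1DK p r) : Prop :=
  ContinuousOn N.k0 (Icc s t) ∧
  ContinuousOn (fun q : ℝ × ℝ => N.k1 q.1 q.2) (Icc s t ×ˢ Icc s t) ∧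
  ContinuousOn (fun q : ℝ × ℝ => N.k2 q.1 q.2) (Icc s t ×ˢ Icc s t)

/-- The 1D-PI operator on `[s,t]` associated with the kernels `N`. -/
def PI1D {p r : ℕ} (s t : ℝ) (N : PI1DK p r) (u : ℝ → Fin r → ℝ) (x : ℝ) :
    Fin p → ℝ :=
  N.k0 x *ᵥ u x + (∫ θ in s..x, N.k1 x θ *ᵥ u θ) + (∫ θ in x..t, N.k2 x θ *ᵥ u θ)

/-- Entrywise interval integral of a matrix-valued function. -/
def mInt {p r : ℕ} (s t : ℝ) (F : ℝ → Matrix (Fin p) (Fin r) ℝ) :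
    Matrix (Fin p) (Fin r) ℝ :=
  Matrix.of fun i j => ∫ η in s..t, F η i j

/-- A family of 2D-PI kernels of size `p × r`. -/
structure PI2DK (p r : ℕ) where
  k00 : ℝ → ℝ → Matrix (Fin p) (Fin r) ℝ
  k10 : ℝ → ℝ → ℝ → Matrix (Fin p) (Fin r) ℝ
  k20 : ℝ → ℝ → ℝ → Matrix (Fin p) (Fin r) ℝ
  k01 : ℝ → ℝ → ℝ → Matrix (Fin p) (Fin r) ℝ
  k02 : ℝ → ℝ → ℝ → Matrix (Fin p) (Fin r) ℝ
  k11 : ℝ → ℝ → ℝ → ℝ → Matrix (Fin p) (Fin r) ℝ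
  k21 : ℝ → ℝ → ℝ → ℝ → Matrix (Fin p) (Fin r) ℝ
  k12 : ℝ → ℝ → ℝ → ℝ → Matrix (Fin p) (Fin r) ℝ
  k22 : ℝ → ℝ → ℝ → ℝ → Matrix (Fin p) (Fin r) ℝ

/-- Continuity of a family of 2D-PI kernels on `[a,b] × [c,d]`. -/
def PI2DK.IsCont {p r : ℕ} (a b c d : ℝ) (N : PI2DK p r) : Prop :=
  ContinuousOn (fun q : ℝ × ℝ => N.k00 q.1 q.2) (Icc a b ×ˢ Icc c d) ∧
  ContinuousOn (fun q : ℝ × ℝ × ℝ => N.k10 q.1 q.2.1 q.2.2)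
    (Icc a b ×ˢ Icc c d ×ˢ Icc a b) ∧
  ContinuousOn (fun q : ℝ × ℝ × ℝ => N.k20 q.1 q.2.1 q.2.2)
    (Icc a b ×ˢ Icc c d ×ˢ Icc a b) ∧
  ContinuousOn (fun q : ℝ × ℝ × ℝ => N.k01 q.1 q.2.1 q.2.2)
    (Icc a b ×ˢ Icc c d ×ˢ Icc c d) ∧
  ContinuousOn (fun q : ℝ × ℝ × ℝ => N.k02 q.1 q.2.1 q.2.2)
    (Icc a b ×ˢ Icc c d ×ˢ Icc c d) ∧
  ContinuousOn (fun q : ℝ × ℝ × ℝ × ℝ => N.k11 q.1 q.2.1 q.2.2.1 q.2.2.2)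
    (Icc a b ×ˢ Icc c d ×ˢ Icc a b ×ˢ Icc c d) ∧
  ContinuousOn (fun q : ℝ × ℝ × ℝ × ℝ => N.k21 q.1 q.2.1 q.2.2.1 q.2.2.2)
    (Icc a b ×ˢ Icc c d ×ˢ Icc a b ×ˢ Icc c d) ∧
  ContinuousOn (fun q : ℝ × ℝ × ℝ × ℝ => N.k12 q.1 q.2.1 q.2.2.1 q.2.2.2)
    (Icc a b ×ˢ Icc c d ×ˢ Icc a b ×ˢ Icc c d) ∧
  ContinuousOn (fun q : ℝ × ℝ × ℝ × ℝ => N.k22 q.1 q.2.1 q.2.2.1 q.2.2.2)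
    (Icc a b ×ˢ Icc c d ×ˢ Icc a b ×ˢ Icc c d)

/-- The 2D-PI operator on `[a,b] × [c,d]` associated with the kernels `N`. -/
def PI2D {p r : ℕ} (a b c d : ℝ) (N : PI2DK p r) (u : ℝ → ℝ → Fin r → ℝ)
    (x y : ℝ) : Fin p → ℝ :=
  N.k00 x y *ᵥ u x y
  + (∫ θ in a..x, N.k10 x y θ *ᵥ u θ y)
  + (∫ θ in x..b, N.k20 x y θ *ᵥ u θ y)
  + (∫ ν in c..y, N.k01 x y ν *ᵥ u x ν)
  + (∫ ν in y..d, N.k02 x y ν *ᵥ u x ν)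
  + (∫ θ in a..x, ∫ ν in c..y, N.k11 x y θ ν *ᵥ u θ ν)
  + (∫ θ in x..b, ∫ ν in c..y, N.k21 x y θ ν *ᵥ u θ ν)
  + (∫ θ in a..x, ∫ ν in y..d, N.k12 x y θ ν *ᵥ u θ ν)
  + (∫ θ in x..b, ∫ ν in y..d, N.k22 x y θ ν *ᵥ u θ ν)

/-- A family of 011-PI kernels of size `(p0,p1) × (r0,r1)`. -/
structure PI011K (p0 p1 r0 r1 : ℕ) where
  b00 : Matrix (Fin p0) (Fin r0) ℝ
  b01 : ℝ → Matrix (Fin p0) (Fin r1) ℝ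
  b02 : ℝ → Matrix (Fin p0) (Fin r1) ℝ
  b10 : ℝ → Matrix (Fin p1) (Fin r0) ℝ
  b20 : ℝ → Matrix (Fin p1) (Fin r0) ℝ
  b12 : ℝ → ℝ → Matrix (Fin p1) (Fin r1) ℝ
  b21 : ℝ → ℝ → Matrix (Fin p1) (Fin r1) ℝ
  b11 : PI1DK p1 r1
  b22 : PI1DK p1 r1

/-- Continuity of a family of 011-PI kernels. -/
def PI011K.IsCont {p0 p1 r0 r1 : ℕ} (a b c d : ℝ) (B : PI011K p0 p1 r0 r1) : Prop :=
  ContinuousOn B.b01 (Icc a b) ∧ ContinuousOn B.b02 (Icc c d) ∧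
  ContinuousOn B.b10 (Icc a b) ∧ ContinuousOn B.b20 (Icc c d) ∧
  ContinuousOn (fun q : ℝ × ℝ => B.b12 q.1 q.2) (Icc a b ×ˢ Icc c d) ∧
  ContinuousOn (fun q : ℝ × ℝ => B.b21 q.1 q.2) (Icc c d ×ˢ Icc a b) ∧
  B.b11.IsCont a b ∧ B.b22.IsCont c d

/-- The 011-PI operator associated with the kernels `B`. -/
def PI011 {p0 p1 r0 r1 : ℕ} (a b c d : ℝ) (B : PI011K p0 p1 r0 r1)
    (v : Fin r0 → ℝ) (u1 u2 : ℝ → Fin r1 → ℝ) :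
    (Fin p0 → ℝ) × (ℝ → Fin p1 → ℝ) × (ℝ → Fin p1 → ℝ) :=
  ( B.b00 *ᵥ v + (∫ θ in a..b, B.b01 θ *ᵥ u1 θ) + (∫ ν in c..d, B.b02 ν *ᵥ u2 ν),
    fun x => B.b10 x *ᵥ v + PI1D a b B.b11 u1 x + (∫ ν in c..d, B.b12 x ν *ᵥ u2 ν),
    fun y => B.b20 y *ᵥ v + (∫ θ in a..b, B.b21 y θ *ᵥ u1 θ) + PI1D c d B.b22 u2 y )

/-- A family of (2D→011)-PI kernels of size `(p0,p1) × r`. -/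
structure PI2Dto011K (p0 p1 r : ℕ) where
  d0 : ℝ → ℝ → Matrix (Fin p0) (Fin r) ℝ
  d10 : ℝ → ℝ → Matrix (Fin p1) (Fin r) ℝ
  d11 : ℝ → ℝ → ℝ → Matrix (Fin p1) (Fin r) ℝ
  d12 : ℝ → ℝ → ℝ → Matrix (Fin p1) (Fin r) ℝ
  d20 : ℝ → ℝ → Matrix (Fin p1) (Fin r) ℝ
  d21 : ℝ → ℝ → ℝ → Matrix (Fin p1) (Fin r) ℝ
  d22 : ℝ → ℝ → ℝ → Matrix (Fin p1) (Fin r) ℝ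

/-- Continuity of a family of (2D→011)-PI kernels. -/
def PI2Dto011K.IsCont {p0 p1 r : ℕ} (a b c d : ℝ) (D : PI2Dto011K p0 p1 r) : Prop :=
  ContinuousOn (fun q : ℝ × ℝ => D.d0 q.1 q.2) (Icc a b ×ˢ Icc c d) ∧
  ContinuousOn (fun q : ℝ × ℝ => D.d10 q.1 q.2) (Icc a b ×ˢ Icc c d) ∧
  ContinuousOn (fun q : ℝ × ℝ × ℝ => D.d11 q.1 q.2.1 q.2.2)
    (Icc a b ×ˢ Icc c d ×ˢ Icc a b) ∧
  ContinuousOn (fun q : ℝ × ℝ × ℝ => D.d12 q.1 q.2.1 q.2.2)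
    (Icc a b ×ˢ Icc c d ×ˢ Icc a b) ∧
  ContinuousOn (fun q : ℝ × ℝ => D.d20 q.1 q.2) (Icc a b ×ˢ Icc c d) ∧
  ContinuousOn (fun q : ℝ × ℝ × ℝ => D.d21 q.1 q.2.1 q.2.2)
    (Icc a b ×ˢ Icc c d ×ˢ Icc c d) ∧
  ContinuousOn (fun q : ℝ × ℝ × ℝ => D.d22 q.1 q.2.1 q.2.2)
    (Icc a b ×ˢ Icc c d ×ˢ Icc c d)

/-- The (2D→011)-PI operator associated with the kernels `D`. -/
def PI2Dto011 {p0 p1 r : ℕ} (a b c d : ℝ) (D : PI2Dto011K p0 p1 r)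
    (u : ℝ → ℝ → Fin r → ℝ) :
    (Fin p0 → ℝ) × (ℝ → Fin p1 → ℝ) × (ℝ → Fin p1 → ℝ) :=
  ( ∫ θ in a..b, ∫ ν in c..d, D.d0 θ ν *ᵥ u θ ν,
    fun x => ∫ y in c..d,
      (D.d10 x y *ᵥ u x y + (∫ θ in a..x, D.d11 x y θ *ᵥ u θ y)
        + (∫ θ in x..b, D.d12 x y θ *ᵥ u θ y)),
    fun y => ∫ x in a..b,
      (D.d20 x y *ᵥ u x y + (∫ ν in c..y, D.d21 x y ν *ᵥ u x ν)
        + (∫ ν in y..d, D.d22 x y ν *ᵥ u x ν)) )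

/-- A family of (011→2D)-PI kernels of size `p × (r0,r1)`. -/
structure PI011to2DK (p r0 r1 : ℕ) where
  e0 : ℝ → ℝ → Matrix (Fin p) (Fin r0) ℝ
  e10 : ℝ → ℝ → Matrix (Fin p) (Fin r1) ℝ
  e11 : ℝ → ℝ → ℝ → Matrix (Fin p) (Fin r1) ℝ
  e12 : ℝ → ℝ → ℝ → Matrix (Fin p) (Fin r1) ℝ
  e20 : ℝ → ℝ → Matrix (Fin p) (Fin r1) ℝ
  e21 : ℝ → ℝ → ℝ → Matrix (Fin p) (Fin r1) ℝ
  e22 : ℝ → ℝ → ℝ → Matrix (Fin p) (Fin r1) ℝ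

/-- Continuity of a family of (011→2D)-PI kernels. -/
def PI011to2DK.IsCont {p r0 r1 : ℕ} (a b c d : ℝ) (E : PI011to2DK p r0 r1) : Prop :=
  ContinuousOn (fun q : ℝ × ℝ => E.e0 q.1 q.2) (Icc a b ×ˢ Icc c d) ∧
  ContinuousOn (fun q : ℝ × ℝ => E.e10 q.1 q.2) (Icc a b ×ˢ Icc c d) ∧
  ContinuousOn (fun q : ℝ × ℝ × ℝ => E.e11 q.1 q.2.1 q.2.2)
    (Icc a b ×ˢ Icc c d ×ˢ Icc a b) ∧
  ContinuousOn (fun q : ℝ × ℝ × ℝ => E.e12 q.1 q.2.1 q.2.2)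
    (Icc a b ×ˢ Icc c d ×ˢ Icc a b) ∧
  ContinuousOn (fun q : ℝ × ℝ => E.e20 q.1 q.2) (Icc a b ×ˢ Icc c d) ∧
  ContinuousOn (fun q : ℝ × ℝ × ℝ => E.e21 q.1 q.2.1 q.2.2)
    (Icc a b ×ˢ Icc c d ×ˢ Icc c d) ∧
  ContinuousOn (fun q : ℝ × ℝ × ℝ => E.e22 q.1 q.2.1 q.2.2)
    (Icc a b ×ˢ Icc c d ×ˢ Icc c d)

/-- The (011→2D)-PI operator associated with the kernels `E`. -/
def PI011to2D {p r0 r1 : ℕ} (a b c d : ℝ) (E : PI011to2DK p r0 r1)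
    (v : Fin r0 → ℝ) (u1 u2 : ℝ → Fin r1 → ℝ) (x y : ℝ) : Fin p → ℝ :=
  E.e0 x y *ᵥ v + E.e10 x y *ᵥ u1 x
  + (∫ θ in a..x, E.e11 x y θ *ᵥ u1 θ) + (∫ θ in x..b, E.e12 x y θ *ᵥ u1 θ)
  + E.e20 x y *ᵥ u2 y
  + (∫ ν in c..y, E.e21 x y ν *ᵥ u2 ν) + (∫ ν in y..d, E.e22 x y ν *ᵥ u2 ν)

section ParametricIntegrals

variable {E : Type*} [NormedAddCommGroup E] [NormedSpace ℝ E]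

/-- A jointly continuous partial derivative on a compact rectangle yields a first-order
expansion that is uniform in the parameter. -/
theorem exists_uniform_first_order_bound {F F' : ℝ → ℝ → E} {a b c d x : ℝ}
    (hF' : ContinuousOn (fun q : ℝ × ℝ => F' q.1 q.2) (Icc a b ×ˢ Icc c d))
    (hd : ∀ θ ∈ Icc c d, ∀ s ∈ Icc a b,
      HasDerivWithinAt (fun s => F s θ) (F' s θ) (Icc a b) s)
    (hx : x ∈ Icc a b) {ε : ℝ} (hε : 0 < ε) :
    ∃ δ > 0, ∀ s ∈ Icc a b, |s - x| < δ → ∀ θ ∈ Icc c d,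
      ‖F s θ - F x θ - (s - x) • F' x θ‖ ≤ ε * |s - x| := by
  have huc := (isCompact_Icc.prod isCompact_Icc).uniformContinuousOn_of_continuous hF'
  obtain ⟨δ, hδ, H⟩ := Metric.uniformContinuousOn_iff.1 huc ε hε
  refine ⟨δ, hδ, fun s hs hsx θ hθ => ?_⟩
  have hsub : uIcc x s ⊆ Icc a b := (ordConnected_Icc).uIcc_subset hx hs
  have key := (convex_uIcc x s).norm_image_sub_le_of_norm_hasDerivWithin_le
    (f := fun t => F t θ - (t - x) • F' x θ) (f' := fun t => F' t θ - (1 : ℝ) • F' x θ) (C := ε)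
    (fun t ht => ((hd θ hθ t (hsub ht)).mono hsub).sub
      (((hasDerivWithinAt_id t _).sub_const x).smul_const (F' x θ)))
    (fun t ht => by
      have hdist : dist (t, θ) (x, θ) < δ := by
        rw [Prod.dist_eq, dist_self, max_eq_left dist_nonneg, Real.dist_eq]
        exact (abs_sub_left_of_mem_uIcc ht).trans_lt hsx
      rw [one_smul, ← dist_eq_norm]
      exact (H (t, θ) ⟨hsub ht, hθ⟩ (x, θ) ⟨hx, hθ⟩ hdist).le)
    left_mem_uIcc right_mem_uIcc
  rw [← Real.norm_eq_abs]
  refine le_trans (le_of_eq ?_) key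
  congr 1
  simp only [sub_self, zero_smul, sub_zero]
  abel

/-- Differentiation under the integral sign over a fixed interval, within a compact interval. -/
theorem hasDerivWithinAt_integral_of_continuousOn {F F' : ℝ → ℝ → E} {a b c d p q x : ℝ}
    (hF : ContinuousOn (fun q : ℝ × ℝ => F q.1 q.2) (Icc a b ×ˢ Icc c d))
    (hF' : ContinuousOn (fun q : ℝ × ℝ => F' q.1 q.2) (Icc a b ×ˢ Icc c d))
    (hd : ∀ θ ∈ Icc c d, ∀ s ∈ Icc a b,
      HasDerivWithinAt (fun s => F s θ) (F' s θ) (Icc a b) s)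
    (hp : p ∈ Icc c d) (hq : q ∈ Icc c d) (hx : x ∈ Icc a b) :
    HasDerivWithinAt (fun s => ∫ θ in p..q, F s θ) (∫ θ in p..q, F' x θ) (Icc a b) x := by
  have hsub : uIcc p q ⊆ Icc c d := (ordConnected_Icc).uIcc_subset hp hq
  have hint {G : ℝ → ℝ → E}
      (hG : ContinuousOn (fun q : ℝ × ℝ => G q.1 q.2) (Icc a b ×ˢ Icc c d))
      {s : ℝ} (hs : s ∈ Icc a b) : IntervalIntegrable (G s) volume p q :=
    (hG.comp (f := fun θ => (s, θ)) (by fun_prop)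
      fun θ hθ => ⟨hs, hsub hθ⟩).intervalIntegrable
  rw [hasDerivWithinAt_iff_isLittleO, Asymptotics.isLittleO_iff]
  intro ε hε
  obtain ⟨δ, hδ, H⟩ := exists_uniform_first_order_bound hF' hd hx
    (div_pos hε (by positivity : 0 < |q - p| + 1))
  filter_upwards [self_mem_nhdsWithin, mem_nhdsWithin_of_mem_nhds (Metric.ball_mem_nhds x hδ)]
    with s hs hsx
  rw [Metric.mem_ball, Real.dist_eq] at hsx
  have hsmul : IntervalIntegrable (fun θ => (s - x) • F' x θ) volume p q :=
    (hint hF' hx).smul (s - x)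
  rw [← intervalIntegral.integral_smul, ← intervalIntegral.integral_sub (hint hF hs) (hint hF hx),
    ← intervalIntegral.integral_sub ((hint hF hs).sub (hint hF hx)) hsmul]
  refine (intervalIntegral.norm_integral_le_of_norm_le_const fun θ hθ =>
    H s hs hsx θ (hsub (uIoc_subset_uIcc hθ))).trans ?_
  rw [Real.norm_eq_abs, div_mul_eq_mul_div, div_mul_eq_mul_div, div_le_iff₀ (by positivity)]
  nlinarith [mul_nonneg hε.le (abs_nonneg (s - x))]

/-- Leibniz rule for an integral whose endpoint is the differentiation variable, within a
compact interval. -/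
theorem hasDerivWithinAt_integral_variable_endpoint [CompleteSpace E]
    {F F' : ℝ → ℝ → E} {a b p x : ℝ}
    (hF : ContinuousOn (fun q : ℝ × ℝ => F q.1 q.2) (Icc a b ×ˢ Icc a b))
    (hF' : ContinuousOn (fun q : ℝ × ℝ => F' q.1 q.2) (Icc a b ×ˢ Icc a b))
    (hd : ∀ θ ∈ Icc a b, ∀ s ∈ Icc a b,
      HasDerivWithinAt (fun s => F s θ) (F' s θ) (Icc a b) s)
    (hp : p ∈ Icc a b) (hx : x ∈ Icc a b) :
    HasDerivWithinAt (fun s => ∫ θ in p..s, F s θ) (F x x + ∫ θ in p..x, F' x θ)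
      (Icc a b) x := by
  have hint {s : ℝ} (hs : s ∈ Icc a b) {q r : ℝ} (hq : q ∈ Icc a b) (hr : r ∈ Icc a b) :
      IntervalIntegrable (F s) volume q r :=
    (hF.comp (f := fun θ => (s, θ)) (by fun_prop) fun θ hθ =>
      ⟨hs, (ordConnected_Icc).uIcc_subset hq hr hθ⟩).intervalIntegrable
  have hend : HasDerivWithinAt (fun s => ∫ θ in x..s, F s θ) (F x x) (Icc a b) x := by
    rw [hasDerivWithinAt_iff_isLittleO, Asymptotics.isLittleO_iff]
    intro ε hε
    obtain ⟨δ, hδ, H⟩ := Metric.continuousOn_iff.1 hF (x, x) ⟨hx, hx⟩ ε hε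
    filter_upwards [self_mem_nhdsWithin, mem_nhdsWithin_of_mem_nhds (Metric.ball_mem_nhds x hδ)]
      with s hs hsx
    rw [Metric.mem_ball, Real.dist_eq] at hsx
    rw [intervalIntegral.integral_same, sub_zero, ← intervalIntegral.integral_const,
      ← intervalIntegral.integral_sub (hint hs hx hs) intervalIntegrable_const]
    refine intervalIntegral.norm_integral_le_of_norm_le_const fun θ hθ => ?_
    have hθ' := uIoc_subset_uIcc hθ
    have hdist : dist (s, θ) (x, x) < δ := by
      rw [Prod.dist_eq, Real.dist_eq, Real.dist_eq]
      exact max_lt hsx ((abs_sub_left_of_mem_uIcc hθ').trans_lt hsx)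
    rw [← dist_eq_norm]
    exact (H (s, θ) ⟨hs, (ordConnected_Icc).uIcc_subset hx hs hθ'⟩ hdist).le
  refine (hend.add (hasDerivWithinAt_integral_of_continuousOn hF hF' hd hp hx hx)).congr_of_mem
    (fun s hs => ?_) hx
  rw [Pi.add_apply, add_comm, intervalIntegral.integral_add_adjacent_intervals
    (hint hs hp hx) (hint hs hx hs)]

/-- An interval integral depends continuously on a parameter ranging in a set. -/
theorem continuousOn_parametric_intervalIntegral {X : Type*} [TopologicalSpace X]
    [FirstCountableTopology X] {G : X → ℝ → E} {S : Set X} {c d p q : ℝ}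
    (hG : ContinuousOn (fun z : X × ℝ => G z.1 z.2) (S ×ˢ Icc c d))
    (hp : p ∈ Icc c d) (hq : q ∈ Icc c d) :
    ContinuousOn (fun z => ∫ ν in p..q, G z ν) S := by
  have hcd : c ≤ d := hp.1.trans hp.2
  rw [continuousOn_iff_continuous_domRestrict]
  have hcont : Continuous (fun z : S × ℝ => G z.1 (projIcc c d hcd z.2)) :=
    hG.comp_continuous (f := fun z : S × ℝ => ((z.1 : X), (projIcc c d hcd z.2 : ℝ)))
      (by fun_prop) fun z => ⟨z.1.2, (projIcc c d hcd z.2).2⟩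
  refine (intervalIntegral.continuous_parametric_intervalIntegral_of_continuous'
    (μ := volume) (f := fun (z : S) ν => G z (projIcc c d hcd ν)) hcont p q).congr fun z => ?_
  refine intervalIntegral.integral_congr fun ν hν => ?_
  simp only [projIcc_of_mem hcd ((ordConnected_Icc).uIcc_subset hp hq hν)]

end ParametricIntegrals

theorem ContinuousOn.mulVec {X : Type*} [TopologicalSpace X] {n m : ℕ} {S : Set X}
    {A : X → Matrix (Fin n) (Fin m) ℝ} {v : X → Fin m → ℝ}
    (hA : ContinuousOn A S) (hv : ContinuousOn v S) :
    ContinuousOn (fun z => A z *ᵥ v z) S :=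
  (Continuous.matrix_mulVec (continuous_fst (X := Matrix (Fin n) (Fin m) ℝ) (Y := Fin m → ℝ))
    continuous_snd).comp_continuousOn (hA.prodMk hv)

theorem HasDerivWithinAt.mulVec_const {n m : ℕ} {A : ℝ → Matrix (Fin n) (Fin m) ℝ}
    {A' : Matrix (Fin n) (Fin m) ℝ} {S : Set ℝ} {x : ℝ}
    (hA : ∀ i j, HasDerivWithinAt (fun s => A s i j) (A' i j) S x) (v : Fin m → ℝ) :
    HasDerivWithinAt (fun s => A s *ᵥ v) (A' *ᵥ v) S x :=
  hasDerivWithinAt_pi.2 fun i => by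
    simp only [mulVec, dotProduct]
    exact HasDerivWithinAt.fun_sum fun j _ => (hA i j).mul_const (v j)

/-- Derivative of an integral term of a PI operator acting in a single variable. -/
theorem hasDerivWithinAt_integral_mulVec {n m : ℕ} {K K' : ℝ → ℝ → Matrix (Fin n) (Fin m) ℝ}
    {v : ℝ → Fin m → ℝ} {a b p x : ℝ}
    (hK : ContinuousOn (fun q : ℝ × ℝ => K q.1 q.2) (Icc a b ×ˢ Icc a b))
    (hK' : ContinuousOn (fun q : ℝ × ℝ => K' q.1 q.2) (Icc a b ×ˢ Icc a b))
    (hd : ∀ θ ∈ Icc a b, ∀ s ∈ Icc a b, ∀ i j,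
      HasDerivWithinAt (fun s => K s θ i j) (K' s θ i j) (Icc a b) s)
    (hv : ContinuousOn v (Icc a b)) (hp : p ∈ Icc a b) (hx : x ∈ Icc a b) :
    HasDerivWithinAt (fun s => ∫ θ in p..s, K s θ *ᵥ v θ)
      (K x x *ᵥ v x + ∫ θ in p..x, K' x θ *ᵥ v θ) (Icc a b) x := by
  have hv' : ContinuousOn (fun q : ℝ × ℝ => v q.2) (Icc a b ×ˢ Icc a b) :=
    hv.comp continuousOn_snd fun q hq => hq.2
  exact hasDerivWithinAt_integral_variable_endpoint (hK.mulVec hv') (hK'.mulVec hv')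
    (fun θ hθ s hs => .mulVec_const (hd θ hθ s hs) (v θ)) hp hx

/-- Derivative of an integral term of a PI operator acting in both variables. -/
theorem hasDerivWithinAt_integral_integral_mulVec {n m : ℕ}
    {K K' : ℝ → ℝ → ℝ → Matrix (Fin n) (Fin m) ℝ} {u : ℝ → ℝ → Fin m → ℝ}
    {a b c d p x e f : ℝ}
    (hK : ContinuousOn (fun q : ℝ × ℝ × ℝ => K q.1 q.2.1 q.2.2)
      (Icc a b ×ˢ Icc a b ×ˢ Icc c d))
    (hK' : ContinuousOn (fun q : ℝ × ℝ × ℝ => K' q.1 q.2.1 q.2.2)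
      (Icc a b ×ˢ Icc a b ×ˢ Icc c d))
    (hd : ∀ θ ∈ Icc a b, ∀ ν ∈ Icc c d, ∀ s ∈ Icc a b, ∀ i j,
      HasDerivWithinAt (fun s => K s θ ν i j) (K' s θ ν i j) (Icc a b) s)
    (hu : ContinuousOn (fun q : ℝ × ℝ => u q.1 q.2) (Icc a b ×ˢ Icc c d))
    (hp : p ∈ Icc a b) (hx : x ∈ Icc a b) (he : e ∈ Icc c d) (hf : f ∈ Icc c d) :
    HasDerivWithinAt (fun s => ∫ θ in p..s, ∫ ν in e..f, K s θ ν *ᵥ u θ ν)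
      ((∫ ν in e..f, K x x ν *ᵥ u x ν) + ∫ θ in p..x, ∫ ν in e..f, K' x θ ν *ᵥ u θ ν)
      (Icc a b) x := by
  have hu' : ContinuousOn (fun q : ℝ × ℝ × ℝ => u q.2.1 q.2.2)
      (Icc a b ×ˢ Icc a b ×ˢ Icc c d) := hu.comp continuousOn_snd fun q hq => hq.2
  have hcont {L : ℝ → ℝ → ℝ → Matrix (Fin n) (Fin m) ℝ}
      (hL : ContinuousOn (fun q : ℝ × ℝ × ℝ => L q.1 q.2.1 q.2.2)
        (Icc a b ×ˢ Icc a b ×ˢ Icc c d)) :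
      ContinuousOn (fun z : ℝ × ℝ => ∫ ν in e..f, L z.1 z.2 ν *ᵥ u z.2 ν)
        (Icc a b ×ˢ Icc a b) :=
    continuousOn_parametric_intervalIntegral (G := fun (z : ℝ × ℝ) ν => L z.1 z.2 ν *ᵥ u z.2 ν)
      ((hL.mulVec hu').comp (f := fun z : (ℝ × ℝ) × ℝ => (z.1.1, z.1.2, z.2)) (by fun_prop)
        fun z hz => ⟨hz.1.1, hz.1.2, hz.2⟩) he hf
  have hslice {L : ℝ → ℝ → ℝ → Matrix (Fin n) (Fin m) ℝ}
      (hL : ContinuousOn (fun q : ℝ × ℝ × ℝ => L q.1 q.2.1 q.2.2)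
        (Icc a b ×ˢ Icc a b ×ˢ Icc c d)) {θ : ℝ} (hθ : θ ∈ Icc a b) :
      ContinuousOn (fun z : ℝ × ℝ => L z.1 θ z.2 *ᵥ u θ z.2) (Icc a b ×ˢ Icc c d) :=
    (hL.mulVec hu').comp (f := fun z : ℝ × ℝ => (z.1, θ, z.2)) (by fun_prop)
      fun z hz => ⟨hz.1, hθ, hz.2⟩
  exact hasDerivWithinAt_integral_variable_endpoint (hcont hK) (hcont hK')
    (fun θ hθ s hs => hasDerivWithinAt_integral_of_continuousOn (hslice hK hθ) (hslice hK' hθ)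
      (fun ν hν t ht => .mulVec_const (hd θ hθ ν hν t ht) (u θ ν)) he hf hs) hp hx

/-- Composition of the differential operator `∂ₓ` with a 2D-PI operator
having no multiplier terms in the `x` direction is again a 2D-PI operator. -/
theorem partial_x_of_2D_PI_operator {n m : ℕ} (a b c d : ℝ)
    (hab : a < b) (hcd : c < d)
    (N M : PI2DK n m) (hN : N.IsCont a b c d)
    (h00 : ∀ x y, N.k00 x y = 0)
    (h01 : ∀ x y ν, N.k01 x y ν = 0)
    (h02 : ∀ x y ν, N.k02 x y ν = 0)
    -- definition of the multiplier kernels of `M`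
    (hM00 : ∀ x y, M.k00 x y = N.k10 x y x - N.k20 x y x)
    (hM01 : ∀ x y ν, M.k01 x y ν = N.k11 x y x ν - N.k21 x y x ν)
    (hM02 : ∀ x y ν, M.k02 x y ν = N.k12 x y x ν - N.k22 x y x ν)
    -- the remaining kernels of `M` are the partial `x`-derivatives of those of `N`
    (hM10 : ∀ y ∈ Icc c d, ∀ θ ∈ Icc a b, ∀ x ∈ Icc a b, ∀ i j,
      HasDerivWithinAt (fun s => N.k10 s y θ i j) (M.k10 x y θ i j) (Icc a b) x)
    (hM20 : ∀ y ∈ Icc c d, ∀ θ ∈ Icc a b, ∀ x ∈ Icc a b, ∀ i j,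
      HasDerivWithinAt (fun s => N.k20 s y θ i j) (M.k20 x y θ i j) (Icc a b) x)
    (hM11 : ∀ y ∈ Icc c d, ∀ θ ∈ Icc a b, ∀ ν ∈ Icc c d, ∀ x ∈ Icc a b, ∀ i j,
      HasDerivWithinAt (fun s => N.k11 s y θ ν i j) (M.k11 x y θ ν i j) (Icc a b) x)
    (hM21 : ∀ y ∈ Icc c d, ∀ θ ∈ Icc a b, ∀ ν ∈ Icc c d, ∀ x ∈ Icc a b, ∀ i j,
      HasDerivWithinAt (fun s => N.k21 s y θ ν i j) (M.k21 x y θ ν i j) (Icc a b) x)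
    (hM12 : ∀ y ∈ Icc c d, ∀ θ ∈ Icc a b, ∀ ν ∈ Icc c d, ∀ x ∈ Icc a b, ∀ i j,
      HasDerivWithinAt (fun s => N.k12 s y θ ν i j) (M.k12 x y θ ν i j) (Icc a b) x)
    (hM22 : ∀ y ∈ Icc c d, ∀ θ ∈ Icc a b, ∀ ν ∈ Icc c d, ∀ x ∈ Icc a b, ∀ i j,
      HasDerivWithinAt (fun s => N.k22 s y θ ν i j) (M.k22 x y θ ν i j) (Icc a b) x)
    -- the partial `x`-derivatives are continuous on the whole domain
    (hc10 : ContinuousOn (fun q : ℝ × ℝ × ℝ => M.k10 q.1 q.2.1 q.2.2)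
      (Icc a b ×ˢ Icc c d ×ˢ Icc a b))
    (hc20 : ContinuousOn (fun q : ℝ × ℝ × ℝ => M.k20 q.1 q.2.1 q.2.2)
      (Icc a b ×ˢ Icc c d ×ˢ Icc a b))
    (hc11 : ContinuousOn (fun q : ℝ × ℝ × ℝ × ℝ => M.k11 q.1 q.2.1 q.2.2.1 q.2.2.2)
      (Icc a b ×ˢ Icc c d ×ˢ Icc a b ×ˢ Icc c d))
    (hc21 : ContinuousOn (fun q : ℝ × ℝ × ℝ × ℝ => M.k21 q.1 q.2.1 q.2.2.1 q.2.2.2)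
      (Icc a b ×ˢ Icc c d ×ˢ Icc a b ×ˢ Icc c d))
    (hc12 : ContinuousOn (fun q : ℝ × ℝ × ℝ × ℝ => M.k12 q.1 q.2.1 q.2.2.1 q.2.2.2)
      (Icc a b ×ˢ Icc c d ×ˢ Icc a b ×ˢ Icc c d))
    (hc22 : ContinuousOn (fun q : ℝ × ℝ × ℝ × ℝ => M.k22 q.1 q.2.1 q.2.2.1 q.2.2.2)
      (Icc a b ×ˢ Icc c d ×ˢ Icc a b ×ˢ Icc c d)) :
    ∀ u : ℝ → ℝ → Fin m → ℝ,
      ContinuousOn (fun q : ℝ × ℝ => u q.1 q.2) (Icc a b ×ˢ Icc c d) →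
      ∀ y ∈ Icc c d, ∀ x ∈ Icc a b,
        HasDerivWithinAt (fun s => PI2D a b c d N u s y)
          (PI2D a b c d M u x y) (Icc a b) x := by
  intro u hu y hy x hx
  obtain ⟨-, hk10, hk20, -, -, hk11, hk21, hk12, hk22⟩ := hN
  have ha : a ∈ Icc a b := left_mem_Icc.2 hab.le
  have hb : b ∈ Icc a b := right_mem_Icc.2 hab.le
  have hc : c ∈ Icc c d := left_mem_Icc.2 hcd.le
  have hd : d ∈ Icc c d := right_mem_Icc.2 hcd.le
  have huy : ContinuousOn (fun θ => u θ y) (Icc a b) :=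
    hu.comp (f := fun θ => (θ, y)) (by fun_prop) fun θ hθ => ⟨hθ, hy⟩
  have slice₁ {L : ℝ → ℝ → ℝ → Matrix (Fin n) (Fin m) ℝ}
      (hL : ContinuousOn (fun q : ℝ × ℝ × ℝ => L q.1 q.2.1 q.2.2)
        (Icc a b ×ˢ Icc c d ×ˢ Icc a b)) :
      ContinuousOn (fun q : ℝ × ℝ => L q.1 y q.2) (Icc a b ×ˢ Icc a b) :=
    hL.comp (f := fun q : ℝ × ℝ => (q.1, y, q.2)) (by fun_prop)
      fun q hq => ⟨hq.1, hy, hq.2⟩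
  have slice₂ {L : ℝ → ℝ → ℝ → ℝ → Matrix (Fin n) (Fin m) ℝ}
      (hL : ContinuousOn (fun q : ℝ × ℝ × ℝ × ℝ => L q.1 q.2.1 q.2.2.1 q.2.2.2)
        (Icc a b ×ˢ Icc c d ×ˢ Icc a b ×ˢ Icc c d)) :
      ContinuousOn (fun q : ℝ × ℝ × ℝ => L q.1 y q.2.1 q.2.2) (Icc a b ×ˢ Icc a b ×ˢ Icc c d) :=
    hL.comp (f := fun q : ℝ × ℝ × ℝ => (q.1, y, q.2)) (by fun_prop)
      fun q hq => ⟨hq.1, hy, hq.2⟩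
  have integrable_trace {L : ℝ → ℝ → ℝ → ℝ → Matrix (Fin n) (Fin m) ℝ}
      (hL : ContinuousOn (fun q : ℝ × ℝ × ℝ × ℝ => L q.1 q.2.1 q.2.2.1 q.2.2.2)
        (Icc a b ×ˢ Icc c d ×ˢ Icc a b ×ˢ Icc c d)) {e f : ℝ}
      (he : e ∈ Icc c d) (hf : f ∈ Icc c d) :
      IntervalIntegrable (fun ν => L x y x ν *ᵥ u x ν) volume e f := by
    have hsub : uIcc e f ⊆ Icc c d := (ordConnected_Icc).uIcc_subset he hf
    refine (ContinuousOn.mulVec (A := fun ν => L x y x ν) ?_ ?_).intervalIntegrable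
    · exact hL.comp (f := fun ν => (x, y, x, ν)) (by fun_prop)
        fun ν hν => ⟨hx, hy, hx, hsub hν⟩
    · exact hu.comp (f := fun ν => (x, ν)) (by fun_prop) fun ν hν => ⟨hx, hsub hν⟩
  have d10 := hasDerivWithinAt_integral_mulVec (slice₁ hk10) (slice₁ hc10) (hM10 y hy) huy ha hx
  have d20 := hasDerivWithinAt_integral_mulVec (slice₁ hk20) (slice₁ hc20) (hM20 y hy) huy hb hx
  have d11 := hasDerivWithinAt_integral_integral_mulVec (slice₂ hk11) (slice₂ hc11) (hM11 y hy)
    hu ha hx hc hy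
  have d21 := hasDerivWithinAt_integral_integral_mulVec (slice₂ hk21) (slice₂ hc21) (hM21 y hy)
    hu hb hx hc hy
  have d12 := hasDerivWithinAt_integral_integral_mulVec (slice₂ hk12) (slice₂ hc12) (hM12 y hy)
    hu ha hx hy hd
  have d22 := hasDerivWithinAt_integral_integral_mulVec (slice₂ hk22) (slice₂ hc22) (hM22 y hy)
    hu hb hx hy hd
  refine (((((d10.sub d20).add d11).sub d21).add d12).sub d22).congr_deriv ?_ |>.congr_of_mem
    (fun s _ => ?_) hx
  · simp only [PI2D, hM00, hM01, hM02, sub_mulVec]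
    rw [intervalIntegral.integral_sub (integrable_trace hk11 hc hy) (integrable_trace hk21 hc hy),
      intervalIntegral.integral_sub (integrable_trace hk12 hy hd) (integrable_trace hk22 hy hd),
      intervalIntegral.integral_symm b x, intervalIntegral.integral_symm b x,
      intervalIntegral.integral_symm b x]
    abel
  · simp only [PI2D, h00, h01, h02, zero_mulVec, intervalIntegral.integral_zero, Pi.add_apply,
      Pi.sub_apply]
    rw [intervalIntegral.integral_symm b s, intervalIntegral.integral_symm b s,
      intervalIntegral.integral_symm b s]
    abel
end
end

section
/- Let N be a family of 2D-PI kernels of size n×m, and define the family N̂ of 2D-PI kernels of size m×n by N̂00(x,y) = N00(x,y)ᵀ; N̂01(x,y,ν) = N02(x,ν,y)ᵀ; N̂02(x,y,ν) = N01(x,ν,y)ᵀ; N̂10(x,y,θ) = N20(θ,y,x)ᵀ; N̂20(x,y,θ) = N10(θ,y,x)ᵀ; N̂11(x,y,θ,ν) = N22(θ,ν,x,y)ᵀ; N̂12(x,y,θ,ν) = N21(θ,ν,x,y)ᵀ; N̂21(x,y,θ,ν) = N12(θ,ν,x,y)ᵀ; N̂22(x,y,θ,ν) = N11(θ,ν,x,y)ᵀ.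 Then for every continuous u : [a,b]×[c,d] → ℝ^m and every continuous v : [a,b]×[c,d] → ℝ^n, ∫_a^b ∫_c^d v(x,y)ᵀ(P[N]u)(x,y) dy dx = ∫_a^b ∫_c^d (P[N̂]v)(x,y)ᵀ u(x,y) dy dx; that is, P[N̂] is the adjoint of P[N] with respect to the L² inner product on [a,b]×[c,d]. -/
open Matrix MeasureTheory Set

noncomputable section

/-! ### Parametric integrals with continuous integrands -/

/-- An integral with continuous integrand and limits depends continuously on the parameter. -/
theorem continuous_intervalIntegral {X E : Type*} [TopologicalSpace X]
    [NormedAddCommGroup E] [NormedSpace ℝ E] {f : X → ℝ → E} (hf : Continuous f.uncurry)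
    {s t : X → ℝ} (hs : Continuous s) (ht : Continuous t) :
    Continuous fun p => ∫ θ in s p..t p, f p θ := by
  have hi : ∀ p r r', IntervalIntegrable (f p) volume r r' := fun p _ _ =>
    (hf.comp (by fun_prop : Continuous fun θ : ℝ => (p, θ))).intervalIntegrable _ _
  have h : ∀ p, ∫ θ in s p..t p, f p θ =
      (∫ θ in (0 : ℝ)..t p, f p θ) - ∫ θ in (0 : ℝ)..s p, f p θ :=
    fun p => (intervalIntegral.integral_interval_sub_left (hi _ _ _) (hi _ _ _)).symm
  simp_rw [h]
  exact (intervalIntegral.continuous_parametric_intervalIntegral_of_continuous hf ht).sub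
    (intervalIntegral.continuous_parametric_intervalIntegral_of_continuous hf hs)

theorem integral_integral_swap_of_continuous {f : ℝ → ℝ → ℝ} (hf : Continuous f.uncurry)
    (a b c d : ℝ) :
    ∫ x in a..b, ∫ y in c..d, f x y = ∫ y in c..d, ∫ x in a..b, f x y :=
  intervalIntegral_intervalIntegral_swap <|
    (hf.continuousOn.integrableOn_compact (isCompact_uIcc.prod isCompact_uIcc)).mono_set
      (prod_mono uIoc_subset_uIcc uIoc_subset_uIcc)

theorem integral_integral_add_of_continuous {f g : ℝ → ℝ → ℝ} (hf : Continuous f.uncurry)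
    (hg : Continuous g.uncurry) (a b c d : ℝ) :
    ∫ x in a..b, ∫ y in c..d, (f x y + g x y)
      = (∫ x in a..b, ∫ y in c..d, f x y) + ∫ x in a..b, ∫ y in c..d, g x y := by
  have hi : ∀ {h : ℝ → ℝ → ℝ}, Continuous h.uncurry → ∀ x, IntervalIntegrable (h x) volume c d :=
    fun hh x => (hh.comp (by fun_prop : Continuous fun y : ℝ => (x, y))).intervalIntegrable _ _
  simp_rw [fun x => intervalIntegral.integral_add (hi hf x) (hi hg x)]
  exact intervalIntegral.integral_add
    ((continuous_intervalIntegral hf continuous_const continuous_const).intervalIntegrable _ _)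
    ((continuous_intervalIntegral hg continuous_const continuous_const).intervalIntegrable _ _)

theorem dotProduct_intervalIntegral {p : ℕ} {f : ℝ → Fin p → ℝ} (hf : Continuous f)
    (w : Fin p → ℝ) (s t : ℝ) :
    w ⬝ᵥ (∫ θ in s..t, f θ) = ∫ θ in s..t, w ⬝ᵥ f θ := by
  let L : (Fin p → ℝ) →L[ℝ] ℝ := LinearMap.toContinuousLinearMap (dotProductBilin ℝ ℝ w)
  exact (L.intervalIntegral_comp_comm (hf.intervalIntegrable s t)).symm

/-- Interchange of the order of integration over a triangle. -/
theorem integral_integral_triangle {f : ℝ → ℝ → ℝ} (hf : Continuous f.uncurry) {a b : ℝ}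
    (hab : a ≤ b) :
    ∫ x in a..b, ∫ θ in a..x, f x θ = ∫ θ in a..b, ∫ x in θ..b, f x θ := by
  let g : ℝ → ℝ → ℝ := fun x θ => indicator {q : ℝ × ℝ | q.2 ≤ q.1} f.uncurry (x, θ)
  have hg : IntegrableOn g.uncurry (uIoc a b ×ˢ uIoc a b) :=
    ((hf.continuousOn.integrableOn_compact (isCompact_uIcc.prod isCompact_uIcc)).mono_set
      (prod_mono uIoc_subset_uIcc uIoc_subset_uIcc)).indicator
      (measurableSet_le measurable_snd measurable_fst)
  calc ∫ x in a..b, ∫ θ in a..x, f x θ = ∫ x in a..b, ∫ θ in a..b, g x θ := by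
        refine intervalIntegral.integral_congr fun x hx => ?_
        rw [uIcc_of_le hab] at hx
        exact (intervalIntegral.integral_indicator (f := f x) hx).symm
    _ = ∫ θ in a..b, ∫ x in a..b, g x θ := intervalIntegral_intervalIntegral_swap hg
    _ = ∫ θ in a..b, ∫ x in θ..b, f x θ := by
        simp_rw [intervalIntegral.integral_of_le hab]
        refine setIntegral_congr_fun measurableSet_Ioc fun θ hθ => ?_
        have hs : Ici θ ∩ Ioc a b = Icc θ b := by
          ext x; exact ⟨fun h => ⟨h.1, h.2.2⟩, fun h => ⟨h.1, hθ.1.trans_le h.1, h.2⟩⟩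
        calc ∫ x in Ioc a b, g x θ = ∫ x in Ioc a b, (Ici θ).indicator (fun x => f x θ) x := rfl
          _ = ∫ x in θ..b, f x θ := by
            rw [integral_indicator measurableSet_Ici, Measure.restrict_restrict measurableSet_Ici,
              hs, integral_Icc_eq_integral_Ioc, intervalIntegral.integral_of_le hθ.2]

/-! ### Dual limits of integration -/

/-- The region `{(x, θ) | s x ≤ θ ≤ t x}` over `[a,b]`, with coordinates exchanged, is the
region with limits `s'` and `t'`. -/
structure DualLimits (a b : ℝ) (s t s' t' : ℝ → ℝ) : Prop where
  continuous_s : Continuous s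
  continuous_t : Continuous t
  continuous_s' : Continuous s'
  continuous_t' : Continuous t'
  integral_swap : ∀ f : ℝ → ℝ → ℝ, Continuous f.uncurry →
    ∫ x in a..b, ∫ θ in s x..t x, f x θ = ∫ x in a..b, ∫ θ in s' x..t' x, f θ x

theorem DualLimits.symm {a b : ℝ} {s t s' t' : ℝ → ℝ} (h : DualLimits a b s t s' t') :
    DualLimits a b s' t' s t where
  continuous_s := h.continuous_s'
  continuous_t := h.continuous_t'
  continuous_s' := h.continuous_s
  continuous_t' := h.continuous_t
  integral_swap f hf :=
    (h.integral_swap (fun x θ => f θ x) (hf.comp continuous_swap)).symm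

theorem dualLimits_lower {a b : ℝ} (hab : a ≤ b) :
    DualLimits a b (fun _ => a) (fun x => x) (fun x => x) (fun _ => b) where
  continuous_s := continuous_const
  continuous_t := continuous_id
  continuous_s' := continuous_id
  continuous_t' := continuous_const
  integral_swap _ hf := integral_integral_triangle hf hab

section Adjoint

variable {n m : ℕ} {a b c d : ℝ} {s t s' t' σ τ σ' τ' : ℝ → ℝ}
  {u : ℝ → ℝ → Fin m → ℝ} {v : ℝ → ℝ → Fin n → ℝ}

theorem dotProduct_mulVec_eq (A : Matrix (Fin n) (Fin m) ℝ) (w : Fin n → ℝ) (z : Fin m → ℝ) :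
    w ⬝ᵥ A *ᵥ z = z ⬝ᵥ Aᵀ *ᵥ w := by
  rw [dotProduct_mulVec, mulVec_transpose, dotProduct_comm]

/-- The adjoint of an integral operator acting along the second variable. -/
theorem adjoint_integral_snd (h : DualLimits c d s t s' t')
    {K : ℝ → ℝ → ℝ → Matrix (Fin n) (Fin m) ℝ}
    (hK : Continuous fun q : ℝ × ℝ × ℝ => K q.1 q.2.1 q.2.2)
    (hu : Continuous fun q : ℝ × ℝ => u q.1 q.2) (hv : Continuous fun q : ℝ × ℝ => v q.1 q.2) :
    ∫ x in a..b, ∫ y in c..d, v x y ⬝ᵥ ∫ ν in s y..t y, K x y ν *ᵥ u x ν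
      = ∫ x in a..b, ∫ y in c..d, u x y ⬝ᵥ ∫ ν in s' y..t' y, (K x ν y)ᵀ *ᵥ v x ν := by
  congr 1 with x
  simp_rw [fun y => dotProduct_intervalIntegral
      (by fun_prop : Continuous fun ν => K x y ν *ᵥ u x ν) (v x y),
    fun y => dotProduct_intervalIntegral
      (by fun_prop : Continuous fun ν => (K x ν y)ᵀ *ᵥ v x ν) (u x y)]
  rw [h.integral_swap (fun y ν => v x y ⬝ᵥ K x y ν *ᵥ u x ν)
    (by simp only [Function.uncurry_def]; fun_prop)]
  simp_rw [fun y ν => dotProduct_mulVec_eq (K x ν y)]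

/-- The adjoint of an integral operator acting along the first variable. -/
theorem adjoint_integral_fst (h : DualLimits a b s t s' t')
    {K : ℝ → ℝ → ℝ → Matrix (Fin n) (Fin m) ℝ}
    (hK : Continuous fun q : ℝ × ℝ × ℝ => K q.1 q.2.1 q.2.2)
    (hu : Continuous fun q : ℝ × ℝ => u q.1 q.2) (hv : Continuous fun q : ℝ × ℝ => v q.1 q.2) :
    ∫ x in a..b, ∫ y in c..d, v x y ⬝ᵥ ∫ θ in s x..t x, K x y θ *ᵥ u θ y
      = ∫ x in a..b, ∫ y in c..d, u x y ⬝ᵥ ∫ θ in s' x..t' x, (K θ y x)ᵀ *ᵥ v θ y := by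
  have hs := h.continuous_s
  have ht := h.continuous_t
  have hs' := h.continuous_s'
  have ht' := h.continuous_t'
  have hl : Continuous fun q : ℝ × ℝ => ∫ θ in s q.1..t q.1, K q.1 q.2 θ *ᵥ u θ q.2 :=
    continuous_intervalIntegral (by simp only [Function.uncurry_def]; fun_prop)
      (by fun_prop) (by fun_prop)
  have hr : Continuous fun q : ℝ × ℝ => ∫ θ in s' q.1..t' q.1, (K θ q.2 q.1)ᵀ *ᵥ v θ q.2 :=
    continuous_intervalIntegral (by simp only [Function.uncurry_def]; fun_prop)
      (by fun_prop) (by fun_prop)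
  refine (integral_integral_swap_of_continuous (by exact hv.dotProduct hl) _ _ _ _).trans
    (Eq.trans ?_ (integral_integral_swap_of_continuous (by exact hu.dotProduct hr) _ _ _ _).symm)
  exact adjoint_integral_snd (u := fun y x => u x y) (v := fun y x => v x y)
    (K := fun y x θ => K x y θ) h (by fun_prop) (by fun_prop) (by fun_prop)

/-- The adjoint of a double integral operator. -/
theorem adjoint_integral_integral (h : DualLimits a b s t s' t') (h' : DualLimits c d σ τ σ' τ')
    {K : ℝ → ℝ → ℝ → ℝ → Matrix (Fin n) (Fin m) ℝ}
    (hK : Continuous fun q : ℝ × ℝ × ℝ × ℝ => K q.1 q.2.1 q.2.2.1 q.2.2.2)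
    (hu : Continuous fun q : ℝ × ℝ => u q.1 q.2) (hv : Continuous fun q : ℝ × ℝ => v q.1 q.2) :
    ∫ x in a..b, ∫ y in c..d, v x y ⬝ᵥ ∫ θ in s x..t x, ∫ ν in σ y..τ y, K x y θ ν *ᵥ u θ ν
      = ∫ x in a..b, ∫ y in c..d,
        u x y ⬝ᵥ ∫ θ in s' x..t' x, ∫ ν in σ' y..τ' y, (K θ ν x y)ᵀ *ᵥ v θ ν := by
  have hσ := h'.continuous_s
  have hτ := h'.continuous_t
  have hσ' := h'.continuous_s'
  have hτ' := h'.continuous_t'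
  have hl : Continuous fun q : ℝ × ℝ × ℝ =>
      ∫ ν in σ q.2.1..τ q.2.1, K q.1 q.2.1 q.2.2 ν *ᵥ u q.2.2 ν :=
    continuous_intervalIntegral (by simp only [Function.uncurry_def]; fun_prop)
      (by fun_prop) (by fun_prop)
  have hr : Continuous fun q : ℝ × ℝ × ℝ =>
      ∫ ν in σ' q.2.1..τ' q.2.1, (K q.2.2 ν q.1 q.2.1)ᵀ *ᵥ v q.2.2 ν :=
    continuous_intervalIntegral (by simp only [Function.uncurry_def]; fun_prop)
      (by fun_prop) (by fun_prop)
  have hlx : ∀ x y, Continuous fun θ => ∫ ν in σ y..τ y, K x y θ ν *ᵥ u θ ν := fun x y =>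
    hl.comp (by fun_prop : Continuous fun θ : ℝ => (x, y, θ))
  have hrx : ∀ x y, Continuous fun θ => ∫ ν in σ' y..τ' y, (K θ ν x y)ᵀ *ᵥ v θ ν := fun x y =>
    hr.comp (by fun_prop : Continuous fun θ : ℝ => (x, y, θ))
  have hl' : Continuous fun q : ℝ × ℝ => ∫ y in c..d, v q.1 y ⬝ᵥ
      ∫ ν in σ y..τ y, K q.1 y q.2 ν *ᵥ u q.2 ν :=
    continuous_intervalIntegral ((by fun_prop :
      Continuous fun q : (ℝ × ℝ) × ℝ => v q.1.1 q.2).dotProduct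
      (hl.comp (by fun_prop : Continuous fun q : (ℝ × ℝ) × ℝ => (q.1.1, q.2, q.1.2))))
      continuous_const continuous_const
  have el : ∀ x, ∫ y in c..d, v x y ⬝ᵥ ∫ θ in s x..t x, ∫ ν in σ y..τ y, K x y θ ν *ᵥ u θ ν
      = ∫ θ in s x..t x, ∫ y in c..d, v x y ⬝ᵥ ∫ ν in σ y..τ y, K x y θ ν *ᵥ u θ ν := by
    intro x
    simp_rw [fun y => dotProduct_intervalIntegral
      (hlx x y) (v x y)]
    refine integral_integral_swap_of_continuous ?_ _ _ _ _
    exact (by fun_prop : Continuous fun q : ℝ × ℝ => v x q.1).dotProduct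
        (hl.comp (by fun_prop : Continuous fun q : ℝ × ℝ => (x, q.1, q.2)))
  have er : ∀ x, ∫ y in c..d,
        u x y ⬝ᵥ ∫ θ in s' x..t' x, ∫ ν in σ' y..τ' y, (K θ ν x y)ᵀ *ᵥ v θ ν
      = ∫ θ in s' x..t' x, ∫ y in c..d,
        u x y ⬝ᵥ ∫ ν in σ' y..τ' y, (K θ ν x y)ᵀ *ᵥ v θ ν := by
    intro x
    simp_rw [fun y => dotProduct_intervalIntegral
      (hrx x y) (u x y)]
    refine integral_integral_swap_of_continuous ?_ _ _ _ _
    exact (by fun_prop : Continuous fun q : ℝ × ℝ => u x q.1).dotProduct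
        (hr.comp (by fun_prop : Continuous fun q : ℝ × ℝ => (x, q.1, q.2)))
  simp_rw [el, er]
  rw [h.integral_swap (fun x θ => ∫ y in c..d, v x y ⬝ᵥ ∫ ν in σ y..τ y, K x y θ ν *ᵥ u θ ν) hl']
  congr 1 with x
  exact adjoint_integral_snd (u := fun _ ν => u x ν) (v := fun θ y => v θ y)
    (K := fun θ y ν => K θ y x ν) h' (by fun_prop) (by fun_prop) (by fun_prop)

end Adjoint

/-! ### Kernel families -/

/-- The kernels of the adjoint 2D-PI operator. -/
def PI2DK.adjoint {p r : ℕ} (N : PI2DK p r) : PI2DK r p where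
  k00 x y := (N.k00 x y)ᵀ
  k10 x y θ := (N.k20 θ y x)ᵀ
  k20 x y θ := (N.k10 θ y x)ᵀ
  k01 x y ν := (N.k02 x ν y)ᵀ
  k02 x y ν := (N.k01 x ν y)ᵀ
  k11 x y θ ν := (N.k22 θ ν x y)ᵀ
  k21 x y θ ν := (N.k12 θ ν x y)ᵀ
  k12 x y θ ν := (N.k21 θ ν x y)ᵀ
  k22 x y θ ν := (N.k11 θ ν x y)ᵀ

/-- Reparametrization of a kernel family by maps of the two coordinates. -/
def PI2DK.comp {p r : ℕ} (N : PI2DK p r) (f g : ℝ → ℝ) : PI2DK p r where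
  k00 x y := N.k00 (f x) (g y)
  k10 x y θ := N.k10 (f x) (g y) (f θ)
  k20 x y θ := N.k20 (f x) (g y) (f θ)
  k01 x y ν := N.k01 (f x) (g y) (g ν)
  k02 x y ν := N.k02 (f x) (g y) (g ν)
  k11 x y θ ν := N.k11 (f x) (g y) (f θ) (g ν)
  k21 x y θ ν := N.k21 (f x) (g y) (f θ) (g ν)
  k12 x y θ ν := N.k12 (f x) (g y) (f θ) (g ν)
  k22 x y θ ν := N.k22 (f x) (g y) (f θ) (g ν)

/-- Continuity of a family of 2D-PI kernels on the whole space. -/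
structure PI2DK.IsGlobCont {p r : ℕ} (N : PI2DK p r) : Prop where
  k00 : Continuous fun q : ℝ × ℝ => N.k00 q.1 q.2
  k10 : Continuous fun q : ℝ × ℝ × ℝ => N.k10 q.1 q.2.1 q.2.2
  k20 : Continuous fun q : ℝ × ℝ × ℝ => N.k20 q.1 q.2.1 q.2.2
  k01 : Continuous fun q : ℝ × ℝ × ℝ => N.k01 q.1 q.2.1 q.2.2
  k02 : Continuous fun q : ℝ × ℝ × ℝ => N.k02 q.1 q.2.1 q.2.2
  k11 : Continuous fun q : ℝ × ℝ × ℝ × ℝ => N.k11 q.1 q.2.1 q.2.2.1 q.2.2.2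
  k21 : Continuous fun q : ℝ × ℝ × ℝ × ℝ => N.k21 q.1 q.2.1 q.2.2.1 q.2.2.2
  k12 : Continuous fun q : ℝ × ℝ × ℝ × ℝ => N.k12 q.1 q.2.1 q.2.2.1 q.2.2.2
  k22 : Continuous fun q : ℝ × ℝ × ℝ × ℝ => N.k22 q.1 q.2.1 q.2.2.1 q.2.2.2

theorem PI2DK.IsGlobCont.adjoint {p r : ℕ} {N : PI2DK p r} (h : N.IsGlobCont) :
    N.adjoint.IsGlobCont := by
  obtain ⟨h00, h10, h20, h01, h02, h11, h21, h12, h22⟩ := h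
  constructor <;> simp only [PI2DK.adjoint] <;> fun_prop

theorem PI2DK.IsCont.comp {p r : ℕ} {a b c d : ℝ} {N : PI2DK p r} (h : N.IsCont a b c d)
    {f g : ℝ → ℝ} (hf : Continuous f) (hg : Continuous g) (hfm : ∀ x, f x ∈ Icc a b)
    (hgm : ∀ y, g y ∈ Icc c d) : (N.comp f g).IsGlobCont := by
  obtain ⟨h00, h10, h20, h01, h02, h11, h21, h12, h22⟩ := h
  exact
    { k00 := h00.comp_continuous (f := fun q : ℝ × ℝ => (f q.1, g q.2)) (by fun_prop)
        fun _ => ⟨hfm _, hgm _⟩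
      k10 := h10.comp_continuous (f := fun q : ℝ × ℝ × ℝ => (f q.1, g q.2.1, f q.2.2))
        (by fun_prop) fun _ => ⟨hfm _, hgm _, hfm _⟩
      k20 := h20.comp_continuous (f := fun q : ℝ × ℝ × ℝ => (f q.1, g q.2.1, f q.2.2))
        (by fun_prop) fun _ => ⟨hfm _, hgm _, hfm _⟩
      k01 := h01.comp_continuous (f := fun q : ℝ × ℝ × ℝ => (f q.1, g q.2.1, g q.2.2))
        (by fun_prop) fun _ => ⟨hfm _, hgm _, hgm _⟩
      k02 := h02.comp_continuous (f := fun q : ℝ × ℝ × ℝ => (f q.1, g q.2.1, g q.2.2))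
        (by fun_prop) fun _ => ⟨hfm _, hgm _, hgm _⟩
      k11 := h11.comp_continuous
        (f := fun q : ℝ × ℝ × ℝ × ℝ => (f q.1, g q.2.1, f q.2.2.1, g q.2.2.2))
        (by fun_prop) fun _ => ⟨hfm _, hgm _, hfm _, hgm _⟩
      k21 := h21.comp_continuous
        (f := fun q : ℝ × ℝ × ℝ × ℝ => (f q.1, g q.2.1, f q.2.2.1, g q.2.2.2))
        (by fun_prop) fun _ => ⟨hfm _, hgm _, hfm _, hgm _⟩
      k12 := h12.comp_continuous
        (f := fun q : ℝ × ℝ × ℝ × ℝ => (f q.1, g q.2.1, f q.2.2.1, g q.2.2.2))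
        (by fun_prop) fun _ => ⟨hfm _, hgm _, hfm _, hgm _⟩
      k22 := h22.comp_continuous
        (f := fun q : ℝ × ℝ × ℝ × ℝ => (f q.1, g q.2.1, f q.2.2.1, g q.2.2.2))
        (by fun_prop) fun _ => ⟨hfm _, hgm _, hfm _, hgm _⟩ }

/-- On the rectangle, the operator depends only on the values of kernels and argument there. -/
theorem PI2D_comp {p r : ℕ} {a b c d : ℝ} (N : PI2DK p r) (u : ℝ → ℝ → Fin r → ℝ)
    {f g : ℝ → ℝ} (hf : ∀ x ∈ Icc a b, f x = x) (hg : ∀ y ∈ Icc c d, g y = y)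
    {x y : ℝ} (hx : x ∈ Icc a b) (hy : y ∈ Icc c d) :
    PI2D a b c d (N.comp f g) (fun x y => u (f x) (g y)) x y = PI2D a b c d N u x y := by
  have ha : a ∈ Icc a b := ⟨le_rfl, hx.1.trans hx.2⟩
  have hb : b ∈ Icc a b := ⟨hx.1.trans hx.2, le_rfl⟩
  have hc : c ∈ Icc c d := ⟨le_rfl, hy.1.trans hy.2⟩
  have hd : d ∈ Icc c d := ⟨hy.1.trans hy.2, le_rfl⟩
  have hF : ∀ {s t : ℝ} (F : ℝ → Fin p → ℝ), s ∈ Icc a b → t ∈ Icc a b →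
      ∫ θ in s..t, F (f θ) = ∫ θ in s..t, F θ := fun F hs ht =>
    intervalIntegral.integral_congr fun θ hθ => congrArg F (hf θ (uIcc_subset_Icc hs ht hθ))
  have hG : ∀ {s t : ℝ} (F : ℝ → Fin p → ℝ), s ∈ Icc c d → t ∈ Icc c d →
      ∫ ν in s..t, F (g ν) = ∫ ν in s..t, F ν := fun F hs ht =>
    intervalIntegral.integral_congr fun ν hν => congrArg F (hg ν (uIcc_subset_Icc hs ht hν))
  simp only [PI2D, PI2DK.comp, hf x hx, hg y hy]
  rw [hF (fun θ => N.k10 x y θ *ᵥ u θ y) ha hx, hF (fun θ => N.k20 x y θ *ᵥ u θ y) hx hb,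
    hG (fun ν => N.k01 x y ν *ᵥ u x ν) hc hy, hG (fun ν => N.k02 x y ν *ᵥ u x ν) hy hd,
    hF (fun θ => ∫ ν in c..y, N.k11 x y θ (g ν) *ᵥ u θ (g ν)) ha hx,
    hF (fun θ => ∫ ν in c..y, N.k21 x y θ (g ν) *ᵥ u θ (g ν)) hx hb,
    hF (fun θ => ∫ ν in y..d, N.k12 x y θ (g ν) *ᵥ u θ (g ν)) ha hx,
    hF (fun θ => ∫ ν in y..d, N.k22 x y θ (g ν) *ᵥ u θ (g ν)) hx hb]
  simp_rw [fun θ => hG (fun ν => N.k11 x y θ ν *ᵥ u θ ν) hc hy,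
    fun θ => hG (fun ν => N.k21 x y θ ν *ᵥ u θ ν) hc hy,
    fun θ => hG (fun ν => N.k12 x y θ ν *ᵥ u θ ν) hy hd,
    fun θ => hG (fun ν => N.k22 x y θ ν *ᵥ u θ ν) hy hd]

/-- The pairing with a 2D-PI operator, term by term. -/
theorem integral_dotProduct_PI2D {p r : ℕ} (a b c d : ℝ) {N : PI2DK p r} (hN : N.IsGlobCont)
    {u : ℝ → ℝ → Fin r → ℝ} {v : ℝ → ℝ → Fin p → ℝ}
    (hu : Continuous fun q : ℝ × ℝ => u q.1 q.2) (hv : Continuous fun q : ℝ × ℝ => v q.1 q.2) :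
    ∫ x in a..b, ∫ y in c..d, v x y ⬝ᵥ PI2D a b c d N u x y
      = (∫ x in a..b, ∫ y in c..d, v x y ⬝ᵥ N.k00 x y *ᵥ u x y)
      + (∫ x in a..b, ∫ y in c..d, v x y ⬝ᵥ ∫ θ in a..x, N.k10 x y θ *ᵥ u θ y)
      + (∫ x in a..b, ∫ y in c..d, v x y ⬝ᵥ ∫ θ in x..b, N.k20 x y θ *ᵥ u θ y)
      + (∫ x in a..b, ∫ y in c..d, v x y ⬝ᵥ ∫ ν in c..y, N.k01 x y ν *ᵥ u x ν)
      + (∫ x in a..b, ∫ y in c..d, v x y ⬝ᵥ ∫ ν in y..d, N.k02 x y ν *ᵥ u x ν)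
      + (∫ x in a..b, ∫ y in c..d,
          v x y ⬝ᵥ ∫ θ in a..x, ∫ ν in c..y, N.k11 x y θ ν *ᵥ u θ ν)
      + (∫ x in a..b, ∫ y in c..d,
          v x y ⬝ᵥ ∫ θ in x..b, ∫ ν in c..y, N.k21 x y θ ν *ᵥ u θ ν)
      + (∫ x in a..b, ∫ y in c..d,
          v x y ⬝ᵥ ∫ θ in a..x, ∫ ν in y..d, N.k12 x y θ ν *ᵥ u θ ν)
      + (∫ x in a..b, ∫ y in c..d,
          v x y ⬝ᵥ ∫ θ in x..b, ∫ ν in y..d, N.k22 x y θ ν *ᵥ u θ ν) := by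
  obtain ⟨h00, h10, h20, h01, h02, h11, h21, h12, h22⟩ := hN
  have hF : ∀ {K : ℝ → ℝ → ℝ → Matrix (Fin p) (Fin r) ℝ} {s t : ℝ → ℝ},
      Continuous (fun q : ℝ × ℝ × ℝ => K q.1 q.2.1 q.2.2) → Continuous s → Continuous t →
      Continuous (Function.uncurry fun x y => v x y ⬝ᵥ ∫ θ in s x..t x, K x y θ *ᵥ u θ y) :=
    fun hK hs ht => hv.dotProduct (continuous_intervalIntegral
      (by simp only [Function.uncurry_def]; fun_prop) (by fun_prop) (by fun_prop))
  have hG : ∀ {K : ℝ → ℝ → ℝ → Matrix (Fin p) (Fin r) ℝ} {s t : ℝ → ℝ},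
      Continuous (fun q : ℝ × ℝ × ℝ => K q.1 q.2.1 q.2.2) → Continuous s → Continuous t →
      Continuous (Function.uncurry fun x y => v x y ⬝ᵥ ∫ ν in s y..t y, K x y ν *ᵥ u x ν) :=
    fun hK hs ht => hv.dotProduct (continuous_intervalIntegral
      (by simp only [Function.uncurry_def]; fun_prop) (by fun_prop) (by fun_prop))
  have hH : ∀ {K : ℝ → ℝ → ℝ → ℝ → Matrix (Fin p) (Fin r) ℝ} {s t σ τ : ℝ → ℝ},
      Continuous (fun q : ℝ × ℝ × ℝ × ℝ => K q.1 q.2.1 q.2.2.1 q.2.2.2) →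
      Continuous s → Continuous t → Continuous σ → Continuous τ →
      Continuous (Function.uncurry fun x y =>
        v x y ⬝ᵥ ∫ θ in s x..t x, ∫ ν in σ y..τ y, K x y θ ν *ᵥ u θ ν) :=
    fun hK hs ht hσ hτ => hv.dotProduct (continuous_intervalIntegral
      (continuous_intervalIntegral
        (f := fun (q : (ℝ × ℝ) × ℝ) ν => _ *ᵥ u q.2 ν)
        (by simp only [Function.uncurry_def]; fun_prop) (by fun_prop) (by fun_prop))
      (by fun_prop) (by fun_prop))
  have c00 : Continuous (Function.uncurry fun x y => v x y ⬝ᵥ N.k00 x y *ᵥ u x y) := by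
    simp only [Function.uncurry_def]; fun_prop
  have c10 := hF (s := fun _ => a) (t := fun x => x)
    h10 continuous_const continuous_id
  have c20 := hF (s := fun x => x) (t := fun _ => b)
    h20 continuous_id continuous_const
  have c01 := hG (s := fun _ => c) (t := fun x => x)
    h01 continuous_const continuous_id
  have c02 := hG (s := fun x => x) (t := fun _ => d)
    h02 continuous_id continuous_const
  have c11 := hH (s := fun _ => a) (t := fun x => x) (σ := fun _ => c) (τ := fun x => x)
    h11 continuous_const continuous_id continuous_const continuous_id
  have c21 := hH (s := fun x => x) (t := fun _ => b) (σ := fun _ => c) (τ := fun x => x)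
    h21 continuous_id continuous_const continuous_const continuous_id
  have c12 := hH (s := fun _ => a) (t := fun x => x) (σ := fun x => x) (τ := fun _ => d)
    h12 continuous_const continuous_id continuous_id continuous_const
  have c22 := hH (s := fun x => x) (t := fun _ => b) (σ := fun x => x) (τ := fun _ => d)
    h22 continuous_id continuous_const continuous_id continuous_const
  simp only [PI2D, dotProduct_add]
  have k10 := c00.add c10
  have k20 := k10.add c20
  have k01 := k20.add c01
  have k02 := k01.add c02
  have k11 := k02.add c11
  have k21 := k11.add c21
  have k12 := k21.add c12
  rw [integral_integral_add_of_continuous ?_ c22, integral_integral_add_of_continuous ?_ c12,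
    integral_integral_add_of_continuous ?_ c21, integral_integral_add_of_continuous ?_ c11,
    integral_integral_add_of_continuous ?_ c02, integral_integral_add_of_continuous ?_ c01,
    integral_integral_add_of_continuous ?_ c20, integral_integral_add_of_continuous c00 c10]
  exacts [k10, k20, k01, k02, k11, k21, k12]

/-- The adjoint identity for globally continuous data. -/
theorem integral_dotProduct_PI2D_adjoint {n m : ℕ} {a b c d : ℝ} (hab : a ≤ b) (hcd : c ≤ d)
    {N : PI2DK n m} (hN : N.IsGlobCont) {u : ℝ → ℝ → Fin m → ℝ} {v : ℝ → ℝ → Fin n → ℝ}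
    (hu : Continuous fun q : ℝ × ℝ => u q.1 q.2) (hv : Continuous fun q : ℝ × ℝ => v q.1 q.2) :
    ∫ x in a..b, ∫ y in c..d, v x y ⬝ᵥ PI2D a b c d N u x y
      = ∫ x in a..b, ∫ y in c..d, u x y ⬝ᵥ PI2D a b c d N.adjoint v x y := by
  rw [integral_dotProduct_PI2D a b c d hN hu hv, integral_dotProduct_PI2D a b c d hN.adjoint hv hu]
  have hx := dualLimits_lower hab
  have hy := dualLimits_lower hcd
  simp only [PI2DK.adjoint]
  rw [adjoint_integral_fst hx hN.k10 hu hv, adjoint_integral_fst hx.symm hN.k20 hu hv,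
    adjoint_integral_snd hy hN.k01 hu hv, adjoint_integral_snd hy.symm hN.k02 hu hv,
    adjoint_integral_integral hx hy hN.k11 hu hv,
    adjoint_integral_integral hx.symm hy hN.k21 hu hv,
    adjoint_integral_integral hx hy.symm hN.k12 hu hv,
    adjoint_integral_integral hx.symm hy.symm hN.k22 hu hv]
  simp_rw [fun x y => dotProduct_mulVec_eq (N.k00 x y)]
  ring

/-- The explicitly given kernel family `Nh` defines the adjoint of the
2D-PI operator `P[N]` with respect to the `L²` inner product on `[a,b] × [c,d]`. -/
theorem adjoint_of_2D_PI_operator {n m : ℕ} (a b c d : ℝ)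
    (hab : a < b) (hcd : c < d)
    (N : PI2DK n m) (hN : N.IsCont a b c d)
    (Nh : PI2DK m n)
    (h00 : ∀ x y, Nh.k00 x y = (N.k00 x y)ᵀ)
    (h01 : ∀ x y ν, Nh.k01 x y ν = (N.k02 x ν y)ᵀ)
    (h02 : ∀ x y ν, Nh.k02 x y ν = (N.k01 x ν y)ᵀ)
    (h10 : ∀ x y θ, Nh.k10 x y θ = (N.k20 θ y x)ᵀ)
    (h20 : ∀ x y θ, Nh.k20 x y θ = (N.k10 θ y x)ᵀ)
    (h11 : ∀ x y θ ν, Nh.k11 x y θ ν = (N.k22 θ ν x y)ᵀ)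
    (h12 : ∀ x y θ ν, Nh.k12 x y θ ν = (N.k21 θ ν x y)ᵀ)
    (h21 : ∀ x y θ ν, Nh.k21 x y θ ν = (N.k12 θ ν x y)ᵀ)
    (h22 : ∀ x y θ ν, Nh.k22 x y θ ν = (N.k11 θ ν x y)ᵀ) :
    ∀ (u : ℝ → ℝ → Fin m → ℝ) (v : ℝ → ℝ → Fin n → ℝ),
      ContinuousOn (fun q : ℝ × ℝ => u q.1 q.2) (Icc a b ×ˢ Icc c d) →
      ContinuousOn (fun q : ℝ × ℝ => v q.1 q.2) (Icc a b ×ˢ Icc c d) →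
      (∫ x in a..b, ∫ y in c..d, v x y ⬝ᵥ PI2D a b c d N u x y)
        = ∫ x in a..b, ∫ y in c..d, PI2D a b c d Nh v x y ⬝ᵥ u x y := by
  intro u v hu hv
  have hNh : Nh = N.adjoint := by
    cases Nh
    simp only [PI2DK.adjoint, PI2DK.mk.injEq]
    simp only at h00 h01 h02 h10 h20 h11 h12 h21 h22
    simp only [funext_iff]
    exact ⟨h00, h10, h20, h01, h02, h11, h21, h12, h22⟩
  subst hNh
  let f : ℝ → ℝ := fun x => projIcc a b hab.le x
  let g : ℝ → ℝ := fun y => projIcc c d hcd.le y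
  have hf : Continuous f := continuous_subtype_val.comp continuous_projIcc
  have hg : Continuous g := continuous_subtype_val.comp continuous_projIcc
  have hfm : ∀ x, f x ∈ Icc a b := fun x => Subtype.coe_prop _
  have hgm : ∀ y, g y ∈ Icc c d := fun y => Subtype.coe_prop _
  have hfe : ∀ x ∈ Icc a b, f x = x := fun x hx => by simp [f, projIcc_of_mem hab.le hx]
  have hge : ∀ y ∈ Icc c d, g y = y := fun y hy => by simp [g, projIcc_of_mem hcd.le hy]
  have hp : Continuous fun q : ℝ × ℝ => (f q.1, g q.2) := by fun_prop
  have key := integral_dotProduct_PI2D_adjoint hab.le hcd.le (hN.comp hf hg hfm hgm)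
    (u := fun x y => u (f x) (g y)) (v := fun x y => v (f x) (g y))
    (hu.comp_continuous hp fun _ => ⟨hfm _, hgm _⟩)
    (hv.comp_continuous hp fun _ => ⟨hfm _, hgm _⟩)
  have congr_rect : ∀ {F G : ℝ → ℝ → ℝ}, (∀ x ∈ Icc a b, ∀ y ∈ Icc c d, F x y = G x y) →
      ∫ x in a..b, ∫ y in c..d, F x y = ∫ x in a..b, ∫ y in c..d, G x y := fun h =>
    intervalIntegral.integral_congr fun x hx => intervalIntegral.integral_congr fun y hy =>
      h x (uIcc_of_le hab.le ▸ hx) y (uIcc_of_le hcd.le ▸ hy)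
  refine Eq.trans (congr_rect fun x hx y hy => ?_) (key.trans (congr_rect fun x hx y hy => ?_))
  · rw [PI2D_comp N u hfe hge hx hy, hfe x hx, hge y hy]
  · rw [dotProduct_comm, hfe x hx, hge y hy]
    exact congrArg (· ⬝ᵥ u x y) (PI2D_comp N.adjoint v hfe hge hx hy)
end
end

section
/- Let a < b and c < d be real numbers, n ∈ ℕ, and let u : [a,b]×[c,d] → ℝ^n be such that all partial derivatives ∂ₓ^i ∂ᵧ^j u for 0 ≤ i,j ≤ 2 exist and are continuous on [a,b]×[c,d]. Then for every (x,y) ∈ [a,b]×[c,d], u(x,y) = u(a,c) + (x−a)·∂ₓu(a,c) + (y−c)·∂ᵧu(a,c) + (y−c)(x−a)·∂ₓ∂ᵧu(a,c) + ∫_a^x (x−θ)·∂ₓ²u(θ,c) dθ + ∫_c^y (y−ν)·∂ᵧ²u(a,ν) dν + (y−c)·∫_a^x (x−θ)·∂ₓ²∂ᵧu(θ,c) dθ + (x−a)·∫_c^y (y−ν)·∂ₓ∂ᵧ²u(a,ν) dν + ∫_c^y ∫_a^x (y−ν)(x−θ)·∂ₓ²∂ᵧ²u(θ,ν) dθ dν.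 -/
open Set

/-- Taylor's formula of order two with integral remainder, for one-sided derivatives on `[a, b]`. -/
theorem taylor_two_integral_remainder {E : Type*} [NormedAddCommGroup E] [NormedSpace ℝ E]
    [CompleteSpace E] {a b : ℝ} {f f' f'' : ℝ → E}
    (hf : ∀ x ∈ Icc a b, HasDerivWithinAt f (f' x) (Icc a b) x)
    (hf' : ∀ x ∈ Icc a b, HasDerivWithinAt f' (f'' x) (Icc a b) x)
    (hf'' : ContinuousOn f'' (Icc a b)) {x : ℝ} (hx : x ∈ Icc a b) :
    f x = f a + (x - a) • f' a + ∫ θ in a..x, (x - θ) • f'' θ := by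
  have hsub : Icc a x ⊆ Icc a b := Icc_subset_Icc_right hx.2
  have hd : ∀ θ ∈ Icc a x,
      HasDerivWithinAt (fun θ => f θ + (x - θ) • f' θ) ((x - θ) • f'' θ) (Icc a x) θ := by
    intro θ hθ
    have h := ((hf θ (hsub hθ)).mono hsub).add
      ((((hasDerivAt_id θ).const_sub x).hasDerivWithinAt (s := Icc a x)).smul
        ((hf' θ (hsub hθ)).mono hsub))
    refine h.congr_deriv ?_
    simp only [id, neg_smul, one_smul]
    abel
  have hint : IntervalIntegrable (fun θ => (x - θ) • f'' θ) MeasureTheory.volume a x := by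
    apply ContinuousOn.intervalIntegrable_of_Icc hx.1
    exact (by fun_prop : ContinuousOn (fun θ : ℝ => x - θ) (Icc a x)).smul (hf''.mono hsub)
  rw [intervalIntegral.integral_eq_sub_of_hasDerivAt_of_le hx.1
    (fun θ hθ => (hd θ hθ).continuousWithinAt)
    (fun θ hθ => (hd θ (Ioo_subset_Icc_self hθ)).hasDerivAt (Icc_mem_nhds hθ.1 hθ.2)) hint]
  simp only [sub_self, zero_smul, add_zero]
  abel

/-- Second-order fundamental theorem of calculus identity on a 2D
rectangle: a function with continuous partial derivatives `∂ₓ^i ∂ᵧ^j u` for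
`0 ≤ i,j ≤ 2` can be reconstructed from corner values, edge data and the highest-order
mixed derivative.  Here `u10 = ∂ₓu`, `u01 = ∂ᵧu`, `u20 = ∂ₓ²u`, `u02 = ∂ᵧ²u`,
`u11 = ∂ₓ∂ᵧu`, `u21 = ∂ₓ²∂ᵧu`, `u12 = ∂ₓ∂ᵧ²u` and `u22 = ∂ₓ²∂ᵧ²u`. -/
theorem fundamental_theorem_of_calculus_2D_second_order {n : ℕ} (a b c d : ℝ)
    (hab : a < b) (hcd : c < d)
    (u u10 u01 u20 u02 u11 u21 u12 u22 : ℝ → ℝ → Fin n → ℝ)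
    -- first-order derivatives
    (h10 : ∀ y ∈ Icc c d, ∀ x ∈ Icc a b,
      HasDerivWithinAt (fun s => u s y) (u10 x y) (Icc a b) x)
    (h01 : ∀ x ∈ Icc a b, ∀ y ∈ Icc c d,
      HasDerivWithinAt (fun t => u x t) (u01 x y) (Icc c d) y)
    -- second-order pure derivatives
    (h20 : ∀ y ∈ Icc c d, ∀ x ∈ Icc a b,
      HasDerivWithinAt (fun s => u10 s y) (u20 x y) (Icc a b) x)
    (h02 : ∀ x ∈ Icc a b, ∀ y ∈ Icc c d,
      HasDerivWithinAt (fun t => u01 x t) (u02 x y) (Icc c d) y)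
    -- mixed derivatives
    (h11 : ∀ y ∈ Icc c d, ∀ x ∈ Icc a b,
      HasDerivWithinAt (fun s => u01 s y) (u11 x y) (Icc a b) x)
    (h21 : ∀ y ∈ Icc c d, ∀ x ∈ Icc a b,
      HasDerivWithinAt (fun s => u11 s y) (u21 x y) (Icc a b) x)
    (h12 : ∀ y ∈ Icc c d, ∀ x ∈ Icc a b,
      HasDerivWithinAt (fun s => u02 s y) (u12 x y) (Icc a b) x)
    (h22 : ∀ y ∈ Icc c d, ∀ x ∈ Icc a b,
      HasDerivWithinAt (fun s => u12 s y) (u22 x y) (Icc a b) x)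
    -- continuity of all partial derivatives on the rectangle
    (hc : ContinuousOn (fun q : ℝ × ℝ => u q.1 q.2) (Icc a b ×ˢ Icc c d))
    (hc10 : ContinuousOn (fun q : ℝ × ℝ => u10 q.1 q.2) (Icc a b ×ˢ Icc c d))
    (hc01 : ContinuousOn (fun q : ℝ × ℝ => u01 q.1 q.2) (Icc a b ×ˢ Icc c d))
    (hc20 : ContinuousOn (fun q : ℝ × ℝ => u20 q.1 q.2) (Icc a b ×ˢ Icc c d))
    (hc02 : ContinuousOn (fun q : ℝ × ℝ => u02 q.1 q.2) (Icc a b ×ˢ Icc c d))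
    (hc11 : ContinuousOn (fun q : ℝ × ℝ => u11 q.1 q.2) (Icc a b ×ˢ Icc c d))
    (hc21 : ContinuousOn (fun q : ℝ × ℝ => u21 q.1 q.2) (Icc a b ×ˢ Icc c d))
    (hc12 : ContinuousOn (fun q : ℝ × ℝ => u12 q.1 q.2) (Icc a b ×ˢ Icc c d))
    (hc22 : ContinuousOn (fun q : ℝ × ℝ => u22 q.1 q.2) (Icc a b ×ˢ Icc c d)) :
    ∀ x ∈ Icc a b, ∀ y ∈ Icc c d,
      u x y = u a c + (x - a) • u10 a c + (y - c) • u01 a c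
        + ((y - c) * (x - a)) • u11 a c
        + (∫ θ in a..x, (x - θ) • u20 θ c)
        + (∫ ν in c..y, (y - ν) • u02 a ν)
        + (y - c) • (∫ θ in a..x, (x - θ) • u21 θ c)
        + (x - a) • (∫ ν in c..y, (y - ν) • u12 a ν)
        + ∫ ν in c..y, ∫ θ in a..x, ((y - ν) * (x - θ)) • u22 θ ν := by
  intro x hx y hy
  have ha : a ∈ Icc a b := left_mem_Icc.2 hab.le
  have hc' : c ∈ Icc c d := left_mem_Icc.2 hcd.le
  have horiz : ∀ {g : ℝ → ℝ → Fin n → ℝ},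
      ContinuousOn (fun q : ℝ × ℝ => g q.1 q.2) (Icc a b ×ˢ Icc c d) →
      ∀ t ∈ Icc c d, ContinuousOn (fun s => g s t) (Icc a b) := fun hg t ht =>
    hg.comp (f := fun s : ℝ => (s, t)) (by fun_prop) fun s hs => ⟨hs, ht⟩
  have vert : ∀ {g : ℝ → ℝ → Fin n → ℝ},
      ContinuousOn (fun q : ℝ × ℝ => g q.1 q.2) (Icc a b ×ˢ Icc c d) →
      ∀ s ∈ Icc a b, ContinuousOn (fun t => g s t) (Icc c d) := fun hg s hs =>
    hg.comp (f := fun t : ℝ => (s, t)) (by fun_prop) fun t ht => ⟨hs, ht⟩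
  have hsub : Icc c y ⊆ Icc c d := Icc_subset_Icc_right hy.2
  have hint : ∀ {g : ℝ → Fin n → ℝ}, ContinuousOn g (Icc c d) →
      IntervalIntegrable (fun ν => (y - ν) • g ν) MeasureTheory.volume c y := fun hg =>
    ContinuousOn.intervalIntegrable_of_Icc hy.1
      ((by fun_prop : ContinuousOn (fun ν : ℝ => y - ν) (Icc c y)).smul (hg.mono hsub))
  have hmixed : ∫ ν in c..y, ∫ θ in a..x, ((y - ν) * (x - θ)) • u22 θ ν =
      (∫ ν in c..y, (y - ν) • u02 x ν) - (∫ ν in c..y, (y - ν) • u02 a ν)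
        - (x - a) • ∫ ν in c..y, (y - ν) • u12 a ν := by
    have hsmul : IntervalIntegrable (fun ν => (x - a) • (y - ν) • u12 a ν)
        MeasureTheory.volume c y := (hint (vert hc12 a ha)).smul (x - a)
    rw [← intervalIntegral.integral_smul, ← intervalIntegral.integral_sub
      (hint (vert hc02 x hx)) (hint (vert hc02 a ha)), ← intervalIntegral.integral_sub
      ((hint (vert hc02 x hx)).sub (hint (vert hc02 a ha))) hsmul]
    refine intervalIntegral.integral_congr fun ν hν => ?_
    rw [uIcc_of_le hy.1] at hν
    have hν' := hsub hν
    have h := taylor_two_integral_remainder (h12 ν hν') (h22 ν hν') (horiz hc22 ν hν') hx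
    simp only [mul_smul, intervalIntegral.integral_smul]
    rw [h]
    module
  have hy_taylor := taylor_two_integral_remainder (h01 x hx) (h02 x hx) (vert hc02 x hx) hy
  have hx_taylor :=
    taylor_two_integral_remainder (h10 c hc') (h20 c hc') (horiz hc20 c hc') hx
  have hx_taylor' :=
    taylor_two_integral_remainder (h11 c hc') (h21 c hc') (horiz hc21 c hc') hx
  rw [hmixed, hy_taylor, hx_taylor, hx_taylor']
  module
end

section
/- Let H be a nontrivial real Hilbert space and let T, A, P : H → H be bounded linear operators with P self-adjoint (⟨Pu, v⟩ = ⟨u, Pv⟩ for all u, v ∈ H). Suppose there are ε > 0 and δ > 0 such that ⟨u, Pu⟩ ≥ ε‖u‖² for all u ∈ H, and ⟨Au, P(Tu)⟩ + ⟨Tu, P(Au)⟩ ≤ −δ‖Tu‖² for all u ∈ H. Let ζ = ‖P‖ be the operator norm of P. Then for every differentiable function û : ℝ → H satisfying T(û'(t)) = A(û(t)) for all t ≥ 0, one has ‖T(û(t))‖² ≤ (ζ/ε)·‖T(û(0))‖²·exp(−(δ/ζ)·t) for all t ≥ 0. -/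
open scoped RealInnerProductSpace

/-- **Grönwall decay**: if `V' ≤ -c V` on `[0, ∞)`, then `V t ≤ V 0 * exp (-c t)` there. -/
theorem le_mul_exp_neg_of_hasDerivAt_le {V V' : ℝ → ℝ} {c : ℝ}
    (hV : ∀ t, 0 ≤ t → HasDerivAt V (V' t) t) (hle : ∀ t, 0 ≤ t → V' t ≤ -c * V t)
    {t : ℝ} (ht : 0 ≤ t) : V t ≤ V 0 * Real.exp (-c * t) := by
  have hW : ∀ s, 0 ≤ s → HasDerivAt (fun s => V s * Real.exp (c * s))
      (V' s * Real.exp (c * s) + V s * (Real.exp (c * s) * c)) s := fun s hs =>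
    (hV s hs).mul (by simpa using ((hasDerivAt_id s).const_mul c).exp)
  have hanti : AntitoneOn (fun s => V s * Real.exp (c * s)) (Set.Ici 0) := by
    refine antitoneOn_of_hasDerivWithinAt_nonpos (convex_Ici 0)
      (fun s hs => (hW s hs).continuousAt.continuousWithinAt)
      (fun s hs => (hW s (interior_subset hs)).hasDerivWithinAt) fun s hs => ?_
    have := mul_le_mul_of_nonneg_right (hle s (interior_subset hs)) (Real.exp_pos (c * s)).le
    linarith
  have h : V t * Real.exp (c * t) ≤ V 0 := by
    simpa using hanti (Set.mem_Ici.2 le_rfl) (Set.mem_Ici.2 ht) ht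
  rwa [neg_mul, Real.exp_neg, ← div_eq_mul_inv, le_div_iff₀ (Real.exp_pos _)]

/-- Lyapunov stability for solutions of a PIE `T uh' = A uh`: a coercive
self-adjoint operator `P` whose associated quadratic form decreases along solutions
certifies exponential decay of `‖T uh(t)‖²`. -/
theorem PIE_exponential_stability {H : Type*} [NormedAddCommGroup H]
    [InnerProductSpace ℝ H] [CompleteSpace H] [Nontrivial H]
    (T A P : H →L[ℝ] H)
    (hPsa : ∀ u v : H, ⟪P u, v⟫ = ⟪u, P v⟫)
    (ε δ : ℝ) (hε : 0 < ε) (hδ : 0 < δ)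
    (hcoer : ∀ u : H, ε * ‖u‖ ^ 2 ≤ ⟪u, P u⟫)
    (hdiss : ∀ u : H, ⟪A u, P (T u)⟫ + ⟪T u, P (A u)⟫ ≤ -δ * ‖T u‖ ^ 2)
    (uh : ℝ → H) (hdiff : Differentiable ℝ uh)
    (hPIE : ∀ t : ℝ, 0 ≤ t → T (deriv uh t) = A (uh t)) :
    ∀ t : ℝ, 0 ≤ t →
      ‖T (uh t)‖ ^ 2 ≤ ‖P‖ / ε * ‖T (uh 0)‖ ^ 2 * Real.exp (-(δ / ‖P‖) * t) := by
  have hquad : ∀ u : H, ⟪u, P u⟫ ≤ ‖P‖ * ‖u‖ ^ 2 := fun u =>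
    calc ⟪u, P u⟫ ≤ ‖u‖ * ‖P u‖ := real_inner_le_norm _ _
      _ ≤ ‖u‖ * (‖P‖ * ‖u‖) := by gcongr; exact P.le_opNorm u
      _ = ‖P‖ * ‖u‖ ^ 2 := by ring
  have hP : 0 < ‖P‖ := by
    obtain ⟨v, hv⟩ := exists_ne (0 : H)
    have hv2 : 0 < ‖v‖ ^ 2 := pow_pos (norm_pos_iff.2 hv) 2
    exact pos_of_mul_pos_left ((mul_pos hε hv2).trans_le ((hcoer v).trans (hquad v))) hv2.le
  intro t ht
  have hderiv : ∀ s, 0 ≤ s → HasDerivAt (fun s => ⟪T (uh s), P (T (uh s))⟫)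
      (⟪T (uh s), P (A (uh s))⟫ + ⟪A (uh s), P (T (uh s))⟫) s := fun s hs => by
    have hT : HasDerivAt (fun s => T (uh s)) (A (uh s)) s :=
      hPIE s hs ▸ T.hasFDerivAt.comp_hasDerivAt s (hdiff s).hasDerivAt
    exact hT.inner ℝ (P.hasFDerivAt.comp_hasDerivAt s hT)
  have hdecay := le_mul_exp_neg_of_hasDerivAt_le (c := δ / ‖P‖) hderiv (fun s _ => by
    have h : δ / ‖P‖ * ⟪T (uh s), P (T (uh s))⟫ ≤ δ * ‖T (uh s)‖ ^ 2 :=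
      calc _ ≤ δ / ‖P‖ * (‖P‖ * ‖T (uh s)‖ ^ 2) := by gcongr; exact hquad _
        _ = δ * ‖T (uh s)‖ ^ 2 := by field_simp
    linarith [hdiss (uh s)]) ht
  have h : ε * ‖T (uh t)‖ ^ 2 ≤ ‖P‖ * ‖T (uh 0)‖ ^ 2 * Real.exp (-(δ / ‖P‖) * t) :=
    ((hcoer _).trans hdecay).trans (by gcongr; exact hquad _)
  rw [div_mul_eq_mul_div, div_mul_eq_mul_div, le_div_iff₀ hε]
  linarith
end
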